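/- arXiv:1908.10242 — 2 statements merged into one kernel-verified Lean document; each statement's English description precedes it below -/
import Mathlib

section
/- The set M_hom(μ_1,…,μ_T) of homogeneous martingale couplings is convex: if Q^a, Q^b ∈ M_hom(μ_1,…,μ_T) and λ ∈ (0,1), then λQ^a + (1−λ)Q^b ∈ M_hom(μ_1,…,μ_T). -/
open MeasureTheory ProbabilityTheory

noncomputable section

/-- The `t`-th one-dimensional marginal of a measure on `ℝ^T`. -/
def marginal {T : ℕ} (Q : Measure (Fin T → ℝ)) (t : Fin T) : Measure ℝ :=
  Q.map (fun x => x t)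

/-- The joint law of the coordinates `(s, u)`. -/
def joint {T : ℕ} (Q : Measure (Fin T → ℝ)) (s u : Fin T) : Measure (ℝ × ℝ) :=
  Q.map (fun x => (x s, x u))

/-- `K` is a disintegration kernel of `Q` over the coordinates `(s, u)`:
`Q_{(s,u)} = Q_s ⊗ K`. -/
def IsDisint {T : ℕ} (Q : Measure (Fin T → ℝ)) (s u : Fin T) (K : Kernel ℝ ℝ) : Prop :=
  IsMarkovKernel K ∧ joint Q s u = (marginal Q s).compProd K

/-- The absolutely continuous part `μ^{ν,abs}` of `μ` with respect to `ν` in the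
Lebesgue decomposition. -/
def absPart (μ ν : Measure ℝ) : Measure ℝ := ν.withDensity (μ.rnDeriv ν)

/-- `Q` is homogeneous: for every `(s,t,τ) ∈ Δ`, the disintegration kernels satisfy
`K_{s,s+τ} = K_{t,t+τ}` a.s. with respect to `Q_s ∧ Q_t`, i.e. w.r.t. the absolutely
continuous part of `Q_s` with respect to `Q_t`. -/
def IsHom {T : ℕ} (Q : Measure (Fin T → ℝ)) : Prop :=
  ∀ (s t : Fin T) (τ : ℕ) (hs : s.val + τ < T) (ht : t.val + τ < T),
    s < t → 1 ≤ τ →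
    ∀ Ks Kt : Kernel ℝ ℝ,
      IsDisint Q s ⟨s.val + τ, hs⟩ Ks → IsDisint Q t ⟨t.val + τ, ht⟩ Kt →
      ∀ᵐ x ∂(absPart (marginal Q s) (marginal Q t)), Ks x = Kt x


/-- The σ-algebra on `ℝ^T` generated by the first `n` coordinates. -/
def natFilt {T : ℕ} (n : ℕ) (h : n ≤ T) : MeasurableSpace (Fin T → ℝ) :=
  MeasurableSpace.comap (fun x (i : Fin n) => x (Fin.castLE h i)) inferInstance

/-- The coordinate process is a martingale in its natural filtration under `Q`:
`E[S_{n+1} | S_1, …, S_n] = S_n` for all `n`. -/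
def IsMartMeasure {T : ℕ} (Q : Measure (Fin T → ℝ)) : Prop :=
  ∀ (n : ℕ) (h : n + 1 < T),
    Q[fun x => x ⟨n + 1, h⟩ | natFilt (n + 1) (by omega)]
      =ᵐ[Q] fun x => x ⟨n, by omega⟩

/-- Convex combination of two kernels. -/
def mixKernel (a b : ENNReal) (K L : Kernel ℝ ℝ) : Kernel ℝ ℝ where
  toFun x := a • K x + b • L x
  measurable' := by
    refine Measure.measurable_of_measurable_coe _ fun s hs => ?_
    simp only [Measure.add_apply, Measure.smul_apply, smul_eq_mul]
    exact ((K.measurable_coe hs).const_mul a).add ((L.measurable_coe hs).const_mul b)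

lemma mixKernel_apply (a b : ENNReal) (K L : Kernel ℝ ℝ) (x : ℝ) :
    mixKernel a b K L x = a • K x + b • L x := rfl

lemma mixKernel_markov {a b : ENNReal} (hab : a + b = 1) (K L : Kernel ℝ ℝ)
    [IsMarkovKernel K] [IsMarkovKernel L] : IsMarkovKernel (mixKernel a b K L) := by
  refine ⟨fun x => ⟨?_⟩⟩
  simp [mixKernel_apply, hab]

lemma compProd_mixKernel {a b : ENNReal} (hab : a + b = 1) (K L : Kernel ℝ ℝ)
    [IsMarkovKernel K] [IsMarkovKernel L] (ν : Measure ℝ) [SFinite ν] :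
    ν.compProd (mixKernel a b K L) = a • ν.compProd K + b • ν.compProd L := by
  have := mixKernel_markov hab K L
  ext s hs
  have hK := Kernel.measurable_kernel_prodMk_left (κ := K) hs
  have hL := Kernel.measurable_kernel_prodMk_left (κ := L) hs
  rw [Measure.compProd_apply hs]
  simp only [Measure.add_apply, Measure.smul_apply, smul_eq_mul, Measure.compProd_apply hs,
    mixKernel_apply]
  rw [lintegral_add_left (hK.const_mul a), lintegral_const_mul a hK, lintegral_const_mul b hL]

lemma map_mix {α β : Type*} [MeasurableSpace α] [MeasurableSpace β] (a b : ENNReal)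
    (P Q : Measure α) {f : α → β} (hf : Measurable f) :
    (a • P + b • Q).map f = a • P.map f + b • Q.map f := by
  rw [Measure.map_add _ _ hf, Measure.map_smul, Measure.map_smul]

lemma exists_isDisint {T : ℕ} (Q : Measure (Fin T → ℝ)) [IsProbabilityMeasure Q]
    (s u : Fin T) : ∃ K, IsDisint Q s u K := by
  refine ⟨condDistrib (fun x => x u) (fun x => x s) Q, inferInstance, ?_⟩
  have h : AEMeasurable (fun x : Fin T → ℝ => x u) Q := (measurable_pi_apply u).aemeasurable
  exact (compProd_map_condDistrib h).symm

lemma mix_disint {T : ℕ} {a b : ENNReal} (hab : a + b = 1) (ν : Measure ℝ)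
    [IsProbabilityMeasure ν]
    (Qa Qb : Measure (Fin T → ℝ)) (s u : Fin T)
    (hma : marginal Qa s = ν) (hmb : marginal Qb s = ν)
    (hm : marginal (a • Qa + b • Qb) s = ν)
    {K Ka Kb : Kernel ℝ ℝ} (hK : IsDisint (a • Qa + b • Qb) s u K)
    (hKa : IsDisint Qa s u Ka) (hKb : IsDisint Qb s u Kb) :
    ∀ᵐ x ∂ν, K x = a • Ka x + b • Kb x := by
  obtain ⟨_, hK⟩ := hK
  obtain ⟨_, hKa⟩ := hKa
  obtain ⟨_, hKb⟩ := hKb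
  rw [hm] at hK
  rw [hma] at hKa
  rw [hmb] at hKb
  have := mixKernel_markov hab Ka Kb
  refine Kernel.ae_eq_of_compProd_eq (η := mixKernel a b Ka Kb) ?_
  rw [compProd_mixKernel hab, ← hK, ← hKa, ← hKb]
  exact map_mix a b Qa Qb (by fun_prop)

lemma natFilt_le {T n : ℕ} (h : n ≤ T) :
    natFilt n h ≤ (inferInstance : MeasurableSpace (Fin T → ℝ)) := by
  refine Measurable.comap_le ?_
  fun_prop

lemma integrable_coord {T : ℕ} {Q : Measure (Fin T → ℝ)} {ν : Measure ℝ} {t : Fin T}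
    (hm : marginal Q t = ν) (hν : Integrable (fun x : ℝ => x) ν) :
    Integrable (fun x : Fin T → ℝ => x t) Q := by
  rw [← hm] at hν
  exact hν.comp_measurable (measurable_pi_apply t)

lemma mart_setIntegral {T : ℕ} {Q : Measure (Fin T → ℝ)} [IsProbabilityMeasure Q]
    (hM : IsMartMeasure Q) (hint : ∀ t, Integrable (fun x : Fin T → ℝ => x t) Q)
    (n : ℕ) (h : n + 1 < T) {A : Set (Fin T → ℝ)}
    (hA : MeasurableSet[natFilt (n + 1) (by omega)] A) :
    ∫ x in A, x ⟨n, by omega⟩ ∂Q = ∫ x in A, x ⟨n + 1, h⟩ ∂Q := by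
  rw [← setIntegral_condExp (natFilt_le _) (hint ⟨n + 1, h⟩) hA]
  exact integral_congr_ae (ae_restrict_of_ae (hM n h).symm)

lemma mart_mix {T : ℕ} {a b : ENNReal} (ha : a ≠ ⊤) (hb : b ≠ ⊤)
    {Qa Qb : Measure (Fin T → ℝ)} [IsProbabilityMeasure Qa] [IsProbabilityMeasure Qb]
    [IsProbabilityMeasure (a • Qa + b • Qb)]
    (hMa : IsMartMeasure Qa) (hMb : IsMartMeasure Qb)
    (hia : ∀ t, Integrable (fun x : Fin T → ℝ => x t) Qa)
    (hib : ∀ t, Integrable (fun x : Fin T → ℝ => x t) Qb) :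
    IsMartMeasure (a • Qa + b • Qb) := by
  intro n h
  have hi : ∀ t, Integrable (fun x : Fin T → ℝ => x t) (a • Qa + b • Qb) := fun t =>
    ((hia t).smul_measure ha).add_measure ((hib t).smul_measure hb)
  symm
  refine ae_eq_condExp_of_forall_setIntegral_eq (natFilt_le _) (hi _)
    (fun s _ _ => (hi _).integrableOn) ?_ ?_
  · intro A hA _
    have key : ∀ t, ∫ x in A, x t ∂(a • Qa + b • Qb)
        = a.toReal * ∫ x in A, x t ∂Qa + b.toReal * ∫ x in A, x t ∂Qb := by
      intro t
      rw [Measure.restrict_add, Measure.restrict_smul, Measure.restrict_smul,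
        integral_add_measure ((hia t).integrableOn.smul_measure ha)
          ((hib t).integrableOn.smul_measure hb), integral_smul_measure, integral_smul_measure]
      rfl
    rw [key, key, mart_setIntegral hMa hia n h hA, mart_setIntegral hMb hib n h hA]
  · refine StronglyMeasurable.aestronglyMeasurable (Measurable.stronglyMeasurable ?_)
    have h1 : Measurable[natFilt (n + 1) (by omega)]
        (fun (x : Fin T → ℝ) (i : Fin (n + 1)) => x (Fin.castLE (by omega) i)) :=
      comap_measurable _
    exact (measurable_pi_apply (Fin.last n)).comp h1

/-- the set `M_hom(μ_1,…,μ_T)` of homogeneous martingale couplings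
is convex. -/
theorem m_hom_convex
    {T : ℕ} (hT : 2 ≤ T) (μ : Fin T → Measure ℝ)
    (hprob : ∀ t, IsProbabilityMeasure (μ t))
    (hmom : ∀ t, Integrable (fun x : ℝ => x) (μ t))
    (Qa Qb : Measure (Fin T → ℝ)) [IsProbabilityMeasure Qa] [IsProbabilityMeasure Qb]
    (hma : ∀ t, marginal Qa t = μ t) (hmb : ∀ t, marginal Qb t = μ t)
    (hMa : IsMartMeasure Qa) (hMb : IsMartMeasure Qb)
    (hha : IsHom Qa) (hhb : IsHom Qb)
    (l : ℝ) (hl0 : 0 < l) (hl1 : l < 1) :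
    IsProbabilityMeasure (ENNReal.ofReal l • Qa + ENNReal.ofReal (1 - l) • Qb) ∧
    (∀ t, marginal (ENNReal.ofReal l • Qa + ENNReal.ofReal (1 - l) • Qb) t = μ t) ∧
    IsMartMeasure (ENNReal.ofReal l • Qa + ENNReal.ofReal (1 - l) • Qb) ∧
    IsHom (ENNReal.ofReal l • Qa + ENNReal.ofReal (1 - l) • Qb) := by
  set a := ENNReal.ofReal l with ha_def
  set b := ENNReal.ofReal (1 - l) with hb_def
  have ha : a ≠ ⊤ := ENNReal.ofReal_ne_top
  have hb : b ≠ ⊤ := ENNReal.ofReal_ne_top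
  have hab : a + b = 1 := by
    rw [ha_def, hb_def, ← ENNReal.ofReal_add hl0.le (by linarith)]
    simp
  have hP : IsProbabilityMeasure (a • Qa + b • Qb) := ⟨by simp [hab]⟩
  have hm : ∀ t, marginal (a • Qa + b • Qb) t = μ t := by
    intro t
    have h1 : marginal (a • Qa + b • Qb) t = a • marginal Qa t + b • marginal Qb t :=
      map_mix a b Qa Qb (measurable_pi_apply t)
    rw [h1, hma, hmb, ← add_smul, hab, one_smul]
  refine ⟨hP, hm, mart_mix ha hb hMa hMb (fun t => integrable_coord (hma t) (hmom t))
    (fun t => integrable_coord (hmb t) (hmom t)), ?_⟩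
  intro s t τ hs ht hst hτ Ks Kt hKs hKt
  have := hprob s
  have := hprob t
  obtain ⟨Kas, hKas⟩ := exists_isDisint Qa s ⟨s.val + τ, hs⟩
  obtain ⟨Kbs, hKbs⟩ := exists_isDisint Qb s ⟨s.val + τ, hs⟩
  obtain ⟨Kat, hKat⟩ := exists_isDisint Qa t ⟨t.val + τ, ht⟩
  obtain ⟨Kbt, hKbt⟩ := exists_isDisint Qb t ⟨t.val + τ, ht⟩
  have hA := hha s t τ hs ht hst hτ Kas Kat hKas hKat
  have hB := hhb s t τ hs ht hst hτ Kbs Kbt hKbs hKbt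
  rw [hma, hma] at hA
  rw [hmb, hmb] at hB
  rw [hm, hm]
  have acs : absPart (μ s) (μ t) ≪ μ s :=
    (Measure.withDensity_rnDeriv_le (μ s) (μ t)).absolutelyContinuous
  have act : absPart (μ s) (μ t) ≪ μ t := withDensity_absolutelyContinuous _ _
  have h1 := acs.ae_le
    (mix_disint hab (μ s) Qa Qb s _ (hma s) (hmb s) (hm s) hKs hKas hKbs)
  have h2 := act.ae_le
    (mix_disint hab (μ t) Qa Qb t _ (hma t) (hmb t) (hm t) hKt hKat hKbt)
  filter_upwards [hA, hB, h1, h2] with x hxa hxb hx1 hx2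
  rw [hx1, hx2, hxa, hxb]
end
end

section
/- Π_hom(μ_1,…,μ_T) is nonempty if and only if there exists a probability measure Q on ℝ^T with marginals Q_t = μ_t for t = 1,…,T under which the coordinate process is a time-homogeneous Markov chain; that is, Π_hom(μ_1,…,μ_T) ≠ ∅ if and only if Π(μ_1,…,μ_T) ∩ P_HM(ℝ^T) ≠ ∅. -/
open MeasureTheory ProbabilityTheory
open scoped ENNReal

noncomputable section

/-- The coordinate process is a time-homogeneous Markov chain with transition kernel `K`
under `Q`: for each `n` with `n+1 < T`, the conditional law of coordinate `n+1` given the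
first `n+1` coordinates is `K` applied to coordinate `n`, expressed via disintegration. -/
def IsHomMarkovChain {T : ℕ} (Q : Measure (Fin T → ℝ)) (K : Kernel ℝ ℝ) : Prop :=
  IsMarkovKernel K ∧
  ∀ (n : ℕ) (hn : n + 1 < T),
    Q.map (fun x => ((fun i : Fin (n + 1) => x (Fin.castLE (by omega) i)), x ⟨n + 1, hn⟩))
      = (Q.map (fun x => fun i : Fin (n + 1) => x (Fin.castLE (by omega) i))).compProd
          (K.comap (fun v : Fin (n + 1) → ℝ => v (Fin.last n)) (measurable_pi_apply _))

/-- A measure dominated by both `μ` and `ν` is dominated by `absPart μ ν`. -/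
lemma ac_absPart (l μ ν : Measure ℝ) [IsFiniteMeasure μ] [IsFiniteMeasure ν]
    (h1 : l ≪ μ) (h2 : l ≪ ν) : l ≪ absPart μ ν := by
  intro A hA
  have hsing := Measure.mutuallySingular_singularPart μ ν
  obtain ⟨N, _, hN1, hN2⟩ := hsing
  have hdec : μ = μ.singularPart ν + ν.withDensity (μ.rnDeriv ν) :=
    Measure.haveLebesgueDecomposition_add μ ν
  have hA1 : l (A ∩ N) = 0 := by
    apply h1
    rw [hdec]
    simp only [Measure.add_apply, add_eq_zero]
    exact ⟨measure_mono_null Set.inter_subset_right hN1,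
      measure_mono_null Set.inter_subset_left hA⟩
  have hA2 : l (A ∩ Nᶜ) = 0 := h2 (measure_mono_null Set.inter_subset_right hN2)
  refine measure_mono_null (fun x hx => ?_) (measure_union_null hA1 hA2)
  by_cases hxN : x ∈ N
  · exact Or.inl ⟨hx, hxN⟩
  · exact Or.inr ⟨hx, hxN⟩

lemma absPart_ac_left (μ ν : Measure ℝ) : absPart μ ν ≪ μ :=
  (Measure.withDensity_rnDeriv_le μ ν).absolutelyContinuous

lemma absPart_ac_right (μ ν : Measure ℝ) : absPart μ ν ≪ ν :=
  withDensity_absolutelyContinuous _ _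

/-- Select measurably one of finitely many kernels. -/
lemma exists_select {ι : Type*} [DecidableEq ι] (S : ι → Set ℝ) (hS : ∀ i, MeasurableSet (S i))
    (κ : ι → Kernel ℝ ℝ) (hκ : ∀ i, IsMarkovKernel (κ i)) (F : Finset ι) :
    ∃ K : Kernel ℝ ℝ, IsMarkovKernel K ∧
      ∀ x, ∀ t ∈ F, x ∈ S t → ∃ s, x ∈ S s ∧ K x = κ s x := by
  classical
  induction F using Finset.induction_on with
  | empty => exact ⟨Kernel.id, inferInstance, by simp⟩
  | insert n F _ ih =>
    obtain ⟨K, hK, h⟩ := ih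
    have := hκ n
    refine ⟨Kernel.piecewise (hS n) (κ n) K, inferInstance, fun x t ht hx => ?_⟩
    by_cases hxn : x ∈ S n
    · exact ⟨n, hxn, by simp [Kernel.piecewise_apply, hxn]⟩
    · have htF : t ∈ F := by
        rcases Finset.mem_insert.1 ht with rfl | h'
        · exact absurd hx hxn
        · exact h'
      obtain ⟨s, hs, e⟩ := h x t htF hx
      exact ⟨s, hs, by simp [Kernel.piecewise_apply, hxn, e]⟩

/-- Gluing of finitely many kernels which agree on the common parts. -/
lemma exists_glue {ι : Type*} [Fintype ι] [DecidableEq ι] (μ : ι → Measure ℝ)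
    (hμ : ∀ i, IsFiniteMeasure (μ i))
    (κ : ι → Kernel ℝ ℝ) (hκ : ∀ i, IsMarkovKernel (κ i))
    (hagree : ∀ s t (l : Measure ℝ), l ≪ μ s → l ≪ μ t → ∀ᵐ x ∂l, κ s x = κ t x) :
    ∃ K : Kernel ℝ ℝ, IsMarkovKernel K ∧ ∀ t, ∀ᵐ x ∂(μ t), K x = κ t x := by
  set ν : Measure ℝ := ∑ i, μ i with hν
  have hle : ∀ i, μ i ≤ ν := fun i => Finset.single_le_sum (f := μ) (fun j _ => Measure.zero_le (μ j)) (Finset.mem_univ i)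
  have hac : ∀ i, μ i ≪ ν := fun i => (hle i).absolutelyContinuous
  have hνf : IsFiniteMeasure ν := by rw [hν]; infer_instance
  have hd : ∀ i, ν.withDensity ((μ i).rnDeriv ν) = μ i :=
    fun i => Measure.withDensity_rnDeriv_eq _ _ (hac i)
  set S : ι → Set ℝ := fun i => {x | (μ i).rnDeriv ν x ≠ 0} with hSdef
  have hS : ∀ i, MeasurableSet (S i) := fun i =>
    (Measure.measurable_rnDeriv (μ i) ν) (measurableSet_singleton 0).compl
  obtain ⟨K, hK, h⟩ := exists_select S hS κ hκ Finset.univ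
  refine ⟨K, hK, fun t => ?_⟩
  have hnull : ∀ i A, μ i A = 0 ↔ ν ({x | (μ i).rnDeriv ν x ≠ 0} ∩ A) = 0 := by
    intro i A
    conv_lhs => rw [← hd i]
    exact withDensity_apply_eq_zero' (Measure.measurable_rnDeriv (μ i) ν).aemeasurable
  have h1 : ∀ᵐ x ∂(μ t), x ∈ S t := by
    rw [ae_iff, hnull]
    convert measure_empty (μ := ν)
    ext x; simp [hSdef]
  have h2 : ∀ s, ∀ᵐ x ∂(μ t), x ∈ S s → κ s x = κ t x := by
    intro s
    rw [← ae_restrict_iff' (hS s)]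
    refine hagree s t _ ?_ (Measure.absolutelyContinuous_of_le Measure.restrict_le_self)
    intro A hA
    rw [Measure.restrict_apply' (hS s), Set.inter_comm]
    exact hac t ((hnull s A).1 hA)
  filter_upwards [h1, ae_all_iff.2 h2] with x hx1 hx2
  obtain ⟨s, hs, e⟩ := h x t (Finset.mem_univ t) hx1
  rw [e, hx2 s hs]

instance marginal_prob {T : ℕ} (Q : Measure (Fin T → ℝ)) [IsProbabilityMeasure Q] (t : Fin T) :
    IsProbabilityMeasure (marginal Q t) :=
  Measure.isProbabilityMeasure_map (measurable_pi_apply t).aemeasurable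

instance joint_prob {T : ℕ} (Q : Measure (Fin T → ℝ)) [IsProbabilityMeasure Q] (s t : Fin T) :
    IsProbabilityMeasure (joint Q s t) :=
  Measure.isProbabilityMeasure_map (by fun_prop)

lemma joint_fst {T : ℕ} (Q : Measure (Fin T → ℝ)) (s t : Fin T) :
    (joint Q s t).fst = marginal Q s := by
  unfold joint marginal Measure.fst
  rw [Measure.map_map (by fun_prop) (by fun_prop)]
  rfl

lemma joint_snd {T : ℕ} (Q : Measure (Fin T → ℝ)) (s t : Fin T) :
    (joint Q s t).snd = marginal Q t := by
  unfold joint marginal Measure.snd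
  rw [Measure.map_map (by fun_prop) (by fun_prop)]
  rfl

lemma exists_disint {T : ℕ} (Q : Measure (Fin T → ℝ)) [IsProbabilityMeasure Q] (s t : Fin T) :
    ∃ K, IsDisint Q s t K := by
  refine ⟨(joint Q s t).condKernel, inferInstance, ?_⟩
  rw [← joint_fst Q s t]
  exact ((joint Q s t).disintegrate _).symm

/-- Iterates of a kernel. -/
def kpow (K : Kernel ℝ ℝ) : ℕ → Kernel ℝ ℝ
  | 0 => Kernel.id
  | n + 1 => K ∘ₖ kpow K n

lemma kpow_markov (K : Kernel ℝ ℝ) [IsMarkovKernel K] (n : ℕ) : IsMarkovKernel (kpow K n) := by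
  induction n with
  | zero => unfold kpow; infer_instance
  | succ n ih => unfold kpow; infer_instance

lemma chain_joint {T : ℕ} (Q : Measure (Fin T → ℝ)) [IsProbabilityMeasure Q] (K : Kernel ℝ ℝ)
    (h : IsHomMarkovChain Q K) (s : Fin T) (τ : ℕ) (hs : s.val + τ < T) :
    joint Q s ⟨s.val + τ, hs⟩ = (marginal Q s).compProd (kpow K τ) := by
  obtain ⟨hK, hc⟩ := h
  have hkp := kpow_markov K
  induction τ with
  | zero =>
    refine Measure.ext_prod fun {A B} hA hB => ?_
    have := hkp 0
    rw [Measure.compProd_apply_prod hA hB, joint, marginal,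
      Measure.map_apply (by fun_prop) (hA.prod hB)]
    simp only [kpow, Kernel.id_apply]
    have : ∀ a, Measure.dirac a B = B.indicator 1 a := fun a => Measure.dirac_apply' a hB
    simp only [this]
    rw [lintegral_indicator_one hB, Measure.restrict_apply hB,
      Measure.map_apply (by fun_prop) (hB.inter hA)]
    congr 1
    ext x
    simp [and_comm]
  | succ τ ih =>
    have ih := ih (by omega)
    have hk1 := hkp τ
    have hk2 := hkp (τ + 1)
    have hn := hc (s.val + τ) hs
    refine Measure.ext_prod fun {A B} hA hB => ?_
    rw [Measure.compProd_apply_prod hA hB]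
    have hpre : MeasurableSet ((fun v : Fin (s.val + τ + 1) → ℝ => v ⟨s.val, by omega⟩) ⁻¹' A) :=
      hA.preimage (measurable_pi_apply _)
    have e1 := congrArg (fun m => m (((fun v : Fin (s.val + τ + 1) → ℝ =>
      v ⟨s.val, by omega⟩) ⁻¹' A) ×ˢ B)) hn
    beta_reduce at e1
    have : IsProbabilityMeasure (Q.map (fun x => fun i : Fin (s.val + τ + 1) =>
      x (Fin.castLE (by omega : s.val + τ + 1 ≤ T) i))) :=
        Measure.isProbabilityMeasure_map
          (measurable_pi_lambda _ fun i => measurable_pi_apply _).aemeasurable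
    rw [Measure.map_apply (by fun_prop) (hpre.prod hB), Measure.compProd_apply_prod hpre hB,
      setLIntegral_map hpre (by
        simp only [Kernel.comap_apply]
        exact (K.measurable_coe hB).comp (measurable_pi_apply _)) (by fun_prop)] at e1
    rw [joint, Measure.map_apply (by fun_prop) (hA.prod hB)]
    refine Eq.trans e1 ?_
    have hm : Measurable (fun p : ℝ × ℝ => K p.2 B) := (K.measurable_coe hB).comp measurable_snd
    have e2 : ∫⁻ p in A ×ˢ Set.univ, K p.2 B ∂(joint Q s ⟨s.val + τ, by omega⟩)
        = ∫⁻ a in A, kpow K (τ + 1) a B ∂(marginal Q s) := by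
      rw [ih, Measure.setLIntegral_compProd hm hA
        MeasurableSet.univ]
      refine lintegral_congr fun a => ?_
      rw [kpow, Kernel.comp_apply' _ _ _ hB, Measure.restrict_univ]
    rw [← e2, joint, setLIntegral_map (hA.prod MeasurableSet.univ)
      hm (by fun_prop)]
    have e3 : ((fun x : Fin T → ℝ => (x s, x ⟨s.val + τ, by omega⟩)) ⁻¹' A ×ˢ Set.univ)
       = ((fun x : Fin T → ℝ => fun i : Fin (s.val + τ + 1) =>
      x (Fin.castLE (by omega : s.val + τ + 1 ≤ T) i)) ⁻¹'
        ((fun v : Fin (s.val + τ + 1) → ℝ => v ⟨s.val, by omega⟩) ⁻¹' A)) := by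
      ext x; simp
    rw [e3]
    rfl

lemma chain_isHom {T : ℕ} (Q : Measure (Fin T → ℝ)) [IsProbabilityMeasure Q] (K : Kernel ℝ ℝ)
    (h : IsHomMarkovChain Q K) : IsHom Q := by
  intro s t τ hs ht _ _ Ks Kt hKs hKt
  have hK := h.1
  have := hKs.1
  have := hKt.1
  have := kpow_markov K τ
  have h1 : Ks =ᵐ[marginal Q s] kpow K τ :=
    Kernel.ae_eq_of_compProd_eq (hKs.2.symm.trans (chain_joint Q K h s τ hs))
  have h2 : Kt =ᵐ[marginal Q t] kpow K τ :=
    Kernel.ae_eq_of_compProd_eq (hKt.2.symm.trans (chain_joint Q K h t τ ht))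
  filter_upwards [(absPart_ac_left _ _).ae_le h1, (absPart_ac_right _ _).ae_le h2] with x a b
  rw [a, b]

/-- Existence of a homogeneous Markov chain with given initial law and kernel. -/
lemma exists_chain (m : Measure ℝ) [IsProbabilityMeasure m] (K : Kernel ℝ ℝ) [hK : IsMarkovKernel K]
    (n : ℕ) : ∃ Q : Measure (Fin (n + 1) → ℝ), IsProbabilityMeasure Q ∧ marginal Q 0 = m ∧
      IsHomMarkovChain Q K := by
  induction n with
  | zero =>
    refine ⟨m.map (fun a _ => a), Measure.isProbabilityMeasure_map (by fun_prop), ?_, hK,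
      fun n hn => by omega⟩
    rw [marginal, Measure.map_map (by fun_prop) (by fun_prop)]
    exact Measure.map_id
  | succ n ih =>
    obtain ⟨Q, hQ, hQ0, _, hc⟩ := ih
    set R : Measure ((Fin (n + 1) → ℝ) × ℝ) := Q.compProd
      (K.comap (fun v : Fin (n + 1) → ℝ => v (Fin.last n)) (measurable_pi_apply _)) with hR
    have hRfst : R.map Prod.fst = Q := Measure.fst_compProd _ _
    let g : (Fin (n + 1) → ℝ) × ℝ → (Fin (n + 2) → ℝ) := fun p => Fin.snoc (α := fun _ => ℝ) p.1 p.2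
    have hgc : ∀ p (i : Fin (n + 1)), g p i.castSucc = p.1 i := fun p i => by simp [g]
    have hgl : ∀ p, g p (Fin.last (n + 1)) = p.2 := fun p => by simp [g]
    have hg : Measurable g := by
      refine measurable_pi_lambda _ fun i => ?_
      induction i using Fin.lastCases with
      | last => simp only [hgl]; fun_prop
      | cast i => simp only [hgc]; fun_prop
    refine ⟨R.map g, Measure.isProbabilityMeasure_map hg.aemeasurable, ?_, hK, ?_⟩
    · rw [← hQ0, marginal, marginal, Measure.map_map (by fun_prop) hg]
      conv_rhs => rw [← hRfst, Measure.map_map (by fun_prop) (by fun_prop)]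
      congr 1
    · intro k hk
      rw [Measure.map_map (by fun_prop) hg, Measure.map_map (by fun_prop) hg]
      rcases Nat.lt_or_ge (k + 1) (n + 1) with hlt | hge
      · have := hc k hlt
        rw [← hRfst, Measure.map_map (by fun_prop) (by fun_prop),
          Measure.map_map (by fun_prop) (by fun_prop)] at this
        convert this using 2
        · ext p
          · exact hgc p (Fin.castLE (by omega) _)
          · exact hgc p ⟨k + 1, hlt⟩
        · congr 1
          ext p i
          exact hgc p (Fin.castLE (by omega) i)
      · obtain rfl : k = n := by omega
        have e1 : ((fun x : Fin (k + 1 + 1) → ℝ =>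
            ((fun i : Fin (k + 1) => x (Fin.castLE (by omega) i)), x ⟨k + 1, hk⟩)) ∘ g) = id := by
          funext p
          refine Prod.ext (funext fun i => hgc p i) (hgl p)
        have e2 : ((fun x : Fin (k + 1 + 1) → ℝ =>
            (fun i : Fin (k + 1) => x (Fin.castLE (by omega) i))) ∘ g) = Prod.fst := by
          funext p
          exact funext fun i => hgc p i
        rw [e1, e2, Measure.map_id, hRfst]

/-- `Π_hom(μ_1,…,μ_T) ≠ ∅` iff there is a coupling of `μ_1,…,μ_T` under
which the coordinate process is a time-homogeneous Markov chain, i.e.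
`Π(μ_1,…,μ_T) ∩ P_HM(ℝ^T) ≠ ∅`. -/
theorem pi_hom_nonempty_iff_homMarkov_coupling
    {T : ℕ} (hT : 2 ≤ T) (μ : Fin T → Measure ℝ)
    (hprob : ∀ t, IsProbabilityMeasure (μ t))
    (hmom : ∀ t, Integrable (fun x : ℝ => x) (μ t)) :
    (∃ Q : Measure (Fin T → ℝ), IsProbabilityMeasure Q ∧
        (∀ t, marginal Q t = μ t) ∧ IsHom Q) ↔
    (∃ Q : Measure (Fin T → ℝ), IsProbabilityMeasure Q ∧
        (∀ t, marginal Q t = μ t) ∧ ∃ K : Kernel ℝ ℝ, IsHomMarkovChain Q K) := by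
  constructor
  · rintro ⟨Q, hQ, hmarg, hhom⟩
    obtain ⟨m, rfl⟩ : ∃ m, T = m + 1 := ⟨T - 1, by omega⟩
    choose κ hκ using fun t : Fin m => exists_disint Q t.castSucc t.succ
    have hlt : ∀ s t : Fin m, s < t → ∀ l : Measure ℝ, l ≪ μ s.castSucc → l ≪ μ t.castSucc →
        ∀ᵐ x ∂l, κ s x = κ t x := by
      intro s t hst l h1 h2
      have h := hhom s.castSucc t.castSucc 1 (by simp) (by simp)
        hst le_rfl (κ s) (κ t) (hκ s) (hκ t)
      rw [hmarg, hmarg] at h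
      exact (ac_absPart l _ _ h1 h2).ae_le h
    obtain ⟨K, hK, hKκ⟩ := exists_glue (fun t : Fin m => μ t.castSucc)
      (fun i => inferInstance) κ (fun i => (hκ i).1) (by
        intro s t l h1 h2
        rcases lt_trichotomy s t with h | rfl | h
        · exact hlt s t h l h1 h2
        · exact Filter.Eventually.of_forall fun _ => rfl
        · exact (hlt t s h l h2 h1).mono fun x hx => hx.symm)
    obtain ⟨P, hP, hP0, hPc⟩ := exists_chain (μ 0) K m
    refine ⟨P, hP, fun t => ?_, K, hPc⟩
    induction t using Fin.induction with
    | zero => exact hP0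
    | succ i ih =>
      have hj := chain_joint P K hPc i.castSucc 1 (by simp)
      have hj' : joint P i.castSucc i.succ = joint Q i.castSucc i.succ := by
        have := (hκ i).1
        have := kpow_markov K 1
        rw [(hκ i).2, hmarg, ← ih]
        refine hj.trans (Measure.compProd_congr ?_)
        rw [ih]
        filter_upwards [hKκ i] with x hx
        rw [← hx]
        simp [kpow]
      rw [← joint_snd P i.castSucc, hj', joint_snd, hmarg]
  · rintro ⟨Q, hQ, hmarg, K, hK⟩
    exact ⟨Q, hQ, hmarg, chain_isHom Q K hK⟩
end
end
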